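/- arXiv:2102.11364 — 2 statements merged into one kernel-verified Lean document; each statement's English description precedes it below -/
import Mathlib

section
/- Let (l∗, r∗, β₁, β₂, V) be a bimodule of a regular BiHom-pre-Lie algebra (A, ∗, α₁, α₂) with β₁ bijective. Then ρ := l∗ − (r∗ ∘ α₁α₂⁻¹)β₁⁻¹β₂ is a representation of the sub-adjacent BiHom-Lie algebra (A, {·,·}, α₁, α₂), where {x,y} = x∗y − α₁⁻¹α₂(y)∗α₁α₂⁻¹(x). -/
universe u

section Defs
variable {A : Type*} {V : Type*} [AddCommGroup A] [AddCommGroup V]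

/-- Commuting pair of maps. -/
def BHComm2 (a1 a2 : A → A) : Prop := ∀ x, a1 (a2 x) = a2 (a1 x)

/-- Multiplicativity of a map with respect to a binary operation. -/
def BHMultip (m : A → A → A) (a : A → A) : Prop := ∀ x y, a (m x y) = m (a x) (a y)

/-- BiHom-associative algebra. -/
def BHAssocAlg (m : A → A → A) (a1 a2 : A → A) : Prop :=
  BHComm2 a1 a2 ∧ BHMultip m a1 ∧ BHMultip m a2 ∧
  ∀ x y z, m (a1 x) (m y z) = m (m x y) (a2 z)

/-- Bimodule of a BiHom-associative algebra. -/
def BHAssocBimod (m : A → A → A) (a1 a2 : A → A)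
    (l r : A → V → V) (b1 b2 : V → V) : Prop :=
  BHComm2 b1 b2 ∧
  (∀ x y v, l (m x y) (b2 v) = l (a1 x) (l y v)) ∧
  (∀ x y v, r (m x y) (b1 v) = r (a2 y) (r x v)) ∧
  (∀ x y v, l (a1 x) (r y v) = r (a2 y) (l x v)) ∧
  (∀ x v, b1 (l x v) = l (a1 x) (b1 v)) ∧
  (∀ x v, b1 (r x v) = r (a1 x) (b1 v)) ∧
  (∀ x v, b2 (l x v) = l (a2 x) (b2 v)) ∧
  (∀ x v, b2 (r x v) = r (a2 x) (b2 v))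

/-- BiHom-Lie algebra. -/
def BHLieAlg (br : A → A → A) (a1 a2 : A → A) : Prop :=
  BHComm2 a1 a2 ∧ BHMultip br a1 ∧ BHMultip br a2 ∧
  (∀ x y, br (a2 x) (a1 y) = - br (a2 y) (a1 x)) ∧
  (∀ x y z,
    br (a2 (a2 x)) (br (a2 y) (a1 z)) + br (a2 (a2 z)) (br (a2 x) (a1 y)) +
      br (a2 (a2 y)) (br (a2 z) (a1 x)) = 0)

/-- Representation of a BiHom-Lie algebra. -/
def BHLieRep (br : A → A → A) (a1 a2 : A → A) (ρ : A → V → V) (b1 b2 : V → V) : Prop :=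
  BHComm2 b1 b2 ∧
  (∀ x y v, ρ (br (a2 x) y) (b2 v) = ρ (a1 (a2 x)) (ρ y v) - ρ (a2 y) (ρ (a1 x) v)) ∧
  (∀ x v, b1 (ρ x v) = ρ (a1 x) (b1 v)) ∧
  (∀ x v, b2 (ρ x v) = ρ (a2 x) (b2 v))

/-- BiHom-Leibniz identity. -/
def BHLeibniz (m br : A → A → A) (a1 a2 : A → A) : Prop :=
  ∀ x y z, br (a1 (a2 x)) (m y z) = m (br (a2 x) y) (a2 z) + m (a2 y) (br (a1 x) z)

/-- Noncommutative BiHom-Poisson algebra. -/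
def BHNCPoisson (m br : A → A → A) (a1 a2 : A → A) : Prop :=
  BHAssocAlg m a1 a2 ∧ BHLieAlg br a1 a2 ∧ BHLeibniz m br a1 a2

/-- Representation of a noncommutative BiHom-Poisson algebra. -/
def BHPoissonRep (m br : A → A → A) (a1 a2 : A → A)
    (l r ρ : A → V → V) (b1 b2 : V → V) : Prop :=
  BHAssocBimod m a1 a2 l r b1 b2 ∧ BHLieRep br a1 a2 ρ b1 b2 ∧
  (∀ x y v, l (br (a2 x) y) (b2 v) = ρ (a1 (a2 x)) (l y v) - l (a2 y) (ρ (a1 x) v)) ∧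
  (∀ x y v, r (br (a1 x) y) (b2 v) = ρ (a1 (a2 x)) (r y v) - r (a2 y) (ρ (a2 x) v)) ∧
  (∀ x y v, ρ (m x y) (b1 (b2 v)) = l (a1 x) (ρ y (b1 v)) + r (a1 y) (ρ x (b2 v)))

/-- BiHom-pre-Lie algebra. -/
def BHPreLieAlg (st : A → A → A) (a1 a2 : A → A) : Prop :=
  BHComm2 a1 a2 ∧ BHMultip st a1 ∧ BHMultip st a2 ∧
  ∀ x y z,
    st (st (a2 x) (a1 y)) (a2 z) - st (a1 (a2 x)) (st (a1 y) z) =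
      st (st (a2 y) (a1 x)) (a2 z) - st (a1 (a2 y)) (st (a1 x) z)

/-- Bimodule of a BiHom-pre-Lie algebra. -/
def BHPreLieBimod (st : A → A → A) (a1 a2 : A → A)
    (lst rst : A → V → V) (b1 b2 : V → V) : Prop :=
  BHComm2 b1 b2 ∧
  (∀ x y v, lst (st (a2 x) (a1 y) - st (a2 y) (a1 x)) (b2 v) =
      lst (a1 (a2 x)) (lst (a1 y) v) - lst (a1 (a2 y)) (lst (a1 x) v)) ∧
  (∀ x y v, rst (a2 y) (lst (a2 x) (b1 v) - rst (a1 x) (b2 v)) =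
      lst (a1 (a2 x)) (rst y (b1 v)) - rst (st (a1 x) y) (b1 (b2 v))) ∧
  (∀ x v, b1 (lst x v) = lst (a1 x) (b1 v)) ∧
  (∀ x v, b1 (rst x v) = rst (a1 x) (b1 v)) ∧
  (∀ x v, b2 (lst x v) = lst (a2 x) (b2 v)) ∧
  (∀ x v, b2 (rst x v) = rst (a2 x) (b2 v))

/-- BiHom-dendriform algebra. -/
def BHDendAlg (p s : A → A → A) (a1 a2 : A → A) : Prop :=
  BHComm2 a1 a2 ∧ BHMultip p a1 ∧ BHMultip p a2 ∧ BHMultip s a1 ∧ BHMultip s a2 ∧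
  (∀ x y z, p (p x y) (a2 z) = p (a1 x) (p y z + s y z)) ∧
  (∀ x y z, p (s x y) (a2 z) = s (a1 x) (p y z)) ∧
  (∀ x y z, s (a1 x) (s y z) = s (p x y + s x y) (a2 z))

/-- Bimodule of a BiHom-dendriform algebra. -/
def BHDendBimod (p s : A → A → A) (a1 a2 : A → A)
    (lp rp ls rs : A → V → V) (b1 b2 : V → V) : Prop :=
  BHComm2 b1 b2 ∧
  (∀ x y v, lp (p x y) (b2 v) = lp (a1 x) (lp y v + ls y v)) ∧
  (∀ x y v, rp (a2 x) (lp y v) = lp (a1 y) (rp x v + rs x v)) ∧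
  (∀ x y v, rp (a2 y) (rp x v) = rp (p x y + s x y) (b1 v)) ∧
  (∀ x y v, lp (s x y) (b2 v) = ls (a1 x) (lp y v)) ∧
  (∀ x y v, rp (a2 x) (ls y v) = ls (a1 y) (rp x v)) ∧
  (∀ x y v, rp (a2 x) (rs y v) = rs (p y x) (b1 v)) ∧
  (∀ x y v, ls (p x y + s x y) (b2 v) = ls (a1 x) (ls y v)) ∧
  (∀ x y v, rs (a2 x) (lp y v + ls y v) = ls (a1 y) (rs x v)) ∧
  (∀ x y v, rs (a2 x) (rp y v + rs y v) = rs (s y x) (b1 v)) ∧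
  (∀ x v, b1 (lp x v) = lp (a1 x) (b1 v)) ∧
  (∀ x v, b1 (rp x v) = rp (a1 x) (b1 v)) ∧
  (∀ x v, b2 (lp x v) = lp (a2 x) (b2 v)) ∧
  (∀ x v, b2 (rp x v) = rp (a2 x) (b2 v)) ∧
  (∀ x v, b1 (ls x v) = ls (a1 x) (b1 v)) ∧
  (∀ x v, b1 (rs x v) = rs (a1 x) (b1 v)) ∧
  (∀ x v, b2 (ls x v) = ls (a2 x) (b2 v)) ∧
  (∀ x v, b2 (rs x v) = rs (a2 x) (b2 v))

/-- The three compatibility conditions of a noncommutative BiHom-pre-Poisson algebra. -/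
def BHPPCompat (p s st : A → A → A) (a1 a2 : A → A) : Prop :=
  (∀ x y z, p (st (a2 x) (a1 y) - st (a2 y) (a1 x)) (a2 z) =
      st (a1 (a2 x)) (p (a1 y) z) - p (a1 (a2 y)) (st (a1 x) z)) ∧
  (∀ x y z, s (a2 x) (st (a1 (a2 y)) (a1 z) - st (a2 z) (a1 (a1 y))) =
      st (a1 (a2 (a2 y))) (s x (a1 z)) - s (st (a2 (a2 y)) x) (a1 (a2 z))) ∧
  (∀ x y z, st (p (a2 x) (a1 y) + s (a2 x) (a1 y)) (a2 z) =
      s (st (a2 x) (a1 z)) (a2 y) + p (a1 (a2 x)) (st (a1 y) z))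

/-- Noncommutative BiHom-pre-Poisson algebra. -/
def BHPrePoisson (p s st : A → A → A) (a1 a2 : A → A) : Prop :=
  BHDendAlg p s a1 a2 ∧ BHPreLieAlg st a1 a2 ∧ BHPPCompat p s st a1 a2

/-- Bimodule of a noncommutative BiHom-pre-Poisson algebra. -/
def BHPrePoissonBimod (p s st : A → A → A) (a1 a2 : A → A)
    (lp rp ls rs lst rst : A → V → V) (b1 b2 : V → V) : Prop :=
  BHPreLieBimod st a1 a2 lst rst b1 b2 ∧
  BHDendBimod p s a1 a2 lp rp ls rs b1 b2 ∧
  (∀ x y v, lp (st (a2 x) (a1 y) - st (a2 y) (a1 x)) (b2 v) =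
      lst (a1 (a2 x)) (lp (a1 y) v) - lp (a1 (a2 y)) (lst (a1 x) v)) ∧
  (∀ x y v, rp (a2 x) (lst (a2 y) (b1 v) - rst (a1 y) (b2 v)) =
      lst (a1 (a2 y)) (rp x (b1 v)) - rp (st (a1 y) x) (b1 (b2 v))) ∧
  (∀ x y v, - rp (a2 x) (lst (a2 y) (b1 v) - rst (a1 y) (b2 v)) =
      rst (p (a1 y) x) (b1 (b2 v)) - lp (a1 (a2 y)) (rst x (b1 v))) ∧
  (∀ x y v, ls (a2 x) (lst (a1 (a2 y)) (b1 v) - rst (a1 (a1 y)) (b2 v)) =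
      lst (a1 (a2 (a2 y))) (ls x (b1 v)) - ls (st (a2 (a2 y)) x) (b1 (b2 v))) ∧
  (∀ x y v, rs (st (a2 (a1 x)) (a1 y) - st (a2 y) (a1 (a1 x))) (b2 v) =
      lst (a1 (a2 (a2 x))) (rs (a1 y) v) - rs (a1 (a2 y)) (lst (a2 (a2 x)) v)) ∧
  (∀ x y v, - ls (a2 x) (lst (a2 y) (b1 (b1 v)) - rst (a1 y) (b2 (b1 v))) =
      rst (s x (a1 y)) (b1 (b2 (b2 v))) - rs (a1 (a2 y)) (rst x (b2 (b2 v)))) ∧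
  (∀ x y v, lst (p (a2 x) (a1 y) + s (a2 x) (a1 y)) (b2 v) =
      rs (a2 y) (lst (a2 x) (b1 v)) + lp (a1 (a2 x)) (lst (a1 y) v)) ∧
  (∀ x y v, rst (a2 x) (lp (a2 y) (b1 v) + ls (a2 y) (b1 v)) =
      ls (st (a2 y) (a1 x)) (b2 v) + lp (a1 (a2 y)) (rst x (b1 v))) ∧
  (∀ x y v, rst (a2 x) (rp (a1 y) (b2 v) + rs (a1 y) (b2 v)) =
      rs (a2 y) (rst (a1 x) (b2 v)) + rp (st (a1 y) x) (b1 (b2 v)))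

end Defs

theorem stmt_3 {K A V : Type*} [Field K] [AddCommGroup A] [Module K A]
    [AddCommGroup V] [Module K V]
    (st : A →ₗ[K] A →ₗ[K] A) (a1 a2 a1inv a2inv : A →ₗ[K] A)
    (lst rst : A →ₗ[K] V →ₗ[K] V) (b1 b2 b1inv : V →ₗ[K] V)
    (hA : BHPreLieAlg (fun x y => st x y) (fun x => a1 x) (fun x => a2 x))
    (hbim : BHPreLieBimod (fun x y => st x y) (fun x => a1 x) (fun x => a2 x)
      (fun x v => lst x v) (fun x v => rst x v) (fun v => b1 v) (fun v => b2 v))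
    (ha1l : ∀ x, a1inv (a1 x) = x) (ha1r : ∀ x, a1 (a1inv x) = x)
    (ha2l : ∀ x, a2inv (a2 x) = x) (ha2r : ∀ x, a2 (a2inv x) = x)
    (hb1l : ∀ v, b1inv (b1 v) = v) (hb1r : ∀ v, b1 (b1inv v) = v) :
    BHLieRep (fun x y => st x y - st (a1inv (a2 y)) (a1 (a2inv x)))
      (fun x => a1 x) (fun x => a2 x)
      (fun x v => lst x v - rst (a1 (a2inv x)) (b1inv (b2 v)))
      (fun v => b1 v) (fun v => b2 v) := by
  obtain ⟨hac, hm1, hm2, -⟩ := hA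
  obtain ⟨hbc, hl, hr, hl1, hr1, hl2, hr2⟩ := hbim
  simp only [BHComm2, BHMultip] at hac hm1 hm2 hbc
  beta_reduce at hl hr hl1 hr1 hl2 hr2
  have hac' : ∀ x, a2 (a1 x) = a1 (a2 x) := fun x => (hac x).symm
  have hbc' : ∀ v, b2 (b1 v) = b1 (b2 v) := fun v => (hbc v).symm
  have hlinv : ∀ x v, b1inv (lst (a1 x) (b1 v)) = lst x v := fun x v => by
    rw [← hl1, hb1l]
  have hrinv : ∀ x v, b1inv (rst (a1 x) (b1 v)) = rst x v := fun x v => by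
    rw [← hr1, hb1l]
  have ha1inv : ∀ x, a1inv (a2 (a1 x)) = a2 x := fun x => by rw [hac', ha1l]
  have ha2inv : ∀ x, a2inv (a1 (a2 x)) = a1 x := fun x => by rw [hac, ha2l]
  have hstinv : ∀ x y, a2inv (st (a2 x) (a2 y)) = st x y := fun x y => by
    rw [← hm2, ha2l]
  have hb1s : ∀ v, ∃ w, b1 w = v := fun v => ⟨_, hb1r v⟩
  have ha1s : ∀ x, ∃ t, a1 t = x := fun x => ⟨_, ha1r x⟩
  have ha2s : ∀ x, ∃ t, a2 t = x := fun x => ⟨_, ha2r x⟩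
  refine ⟨hbc, fun x y v => ?_, fun x v => ?_, fun x v => ?_⟩
  · obtain ⟨t, rfl⟩ := ha2s x
    obtain ⟨y, rfl⟩ := ha1s y
    obtain ⟨z, rfl⟩ := ha2s y
    obtain ⟨v, rfl⟩ := hb1s v
    obtain ⟨w, rfl⟩ := hb1s v
    have e1 := hl (a2 t) (a2 z) (b1 (b1 w))
    have e2 := hr (a2 t) (a1 (a1 z)) (b2 w)
    have e3 := hr (a2 z) (a1 (a1 t)) (b2 w)
    have k : a2inv (st (a2 (a2 t)) (a1 (a2 z)) - st (a2 (a2 z)) (a1 (a2 t))) =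
        st (a2 t) (a1 z) - st (a2 z) (a1 t) := by
      rw [map_sub, hac, hac, hstinv, hstinv]
    simp only [ha1inv, ha2l, k]
    simp only [map_sub, LinearMap.sub_apply, hac', hbc', hl2, hr2, hm1, hlinv, hrinv, hb1l,
      ha2inv] at e1 e2 e3 ⊢
    rw [e1]
    linear_combination (norm := abel) e3 - e2
  · obtain ⟨t, rfl⟩ := ha2s x
    obtain ⟨w, rfl⟩ := hb1s v
    simp only [map_sub, hl1, hr1, hbc', hb1l, ha2l, ha2inv]
  · obtain ⟨t, rfl⟩ := ha2s x
    obtain ⟨w, rfl⟩ := hb1s v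
    simp only [map_sub, hl2, hr2, hac', hbc', hb1l, ha2l]
end

section
/- Let (l, r, ρ, β₁, β₂, V) be a representation of a noncommutative BiHom-Poisson algebra (A, ·, {·,·}, α₁, α₂) with α₁ and β₂ bijective. Then A ⊕ V equipped with the semidirect product associative product (x₁+v₁)·'(x₂+v₂) = x₁·x₂ + l(x₁)v₂ + r(x₂)v₁, the semidirect product bracket {x₁+v₁, x₂+v₂}' = {x₁,x₂} + ρ(x₁)v₂ − ρ(α₁⁻¹α₂(x₂))β₁β₂⁻¹(v₁), and structure maps α₁⊕β₁, α₂⊕β₂, is a noncommutative BiHom-Poisson algebra. -/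
universe u

theorem stmt_8 {K A V : Type*} [Field K] [AddCommGroup A] [Module K A]
    [AddCommGroup V] [Module K V]
    (mul br : A →ₗ[K] A →ₗ[K] A) (a1 a2 a1inv : A →ₗ[K] A)
    (l r ρ : A →ₗ[K] V →ₗ[K] V) (b1 b2 b2inv : V →ₗ[K] V)
    (hP : BHNCPoisson (fun x y => mul x y) (fun x y => br x y) (fun x => a1 x) (fun x => a2 x))
    (hrep : BHPoissonRep (fun x y => mul x y) (fun x y => br x y) (fun x => a1 x) (fun x => a2 x)
      (fun x v => l x v) (fun x v => r x v) (fun x v => ρ x v) (fun v => b1 v) (fun v => b2 v))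
    (ha1l : ∀ x, a1inv (a1 x) = x) (ha1r : ∀ x, a1 (a1inv x) = x)
    (hb2l : ∀ v, b2inv (b2 v) = v) (hb2r : ∀ v, b2 (b2inv v) = v) :
    BHNCPoisson
      (fun q w : A × V => (mul q.1 w.1, l q.1 w.2 + r w.1 q.2))
      (fun q w : A × V =>
        (br q.1 w.1, ρ q.1 w.2 - ρ (a1inv (a2 w.1)) (b1 (b2inv q.2))))
      (fun q => (a1 q.1, b1 q.2)) (fun q => (a2 q.1, b2 q.2)) := by
  obtain ⟨⟨hcomm, hmul1, hmul2, hassoc⟩, ⟨-, hbr1, hbr2, hskew, hjac⟩, hleib⟩ := hP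
  obtain ⟨⟨hbcomm, hll, hrr, hlr, hl1, hr1, hl2, hr2⟩, ⟨-, hρbr, hρ1, hρ2⟩,
    hlbr, hrbr, hρmul⟩ := hrep
  simp only [BHComm2, BHMultip] at *
  have hainv (x : A) : a2 (a1inv x) = a1inv (a2 x) := by
    rw [← ha1l (a2 (a1inv x)), hcomm, ha1r]
  have hbinv (v : V) : b1 (b2inv v) = b2inv (b1 v) := by
    rw [← hb2l (b1 (b2inv v)), ← hbcomm, hb2r]
  have hbrinv (x y : A) : a1inv (br x y) = br (a1inv x) (a1inv y) := by
    rw [← ha1l (br (a1inv x) (a1inv y)), hbr1, ha1r, ha1r]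
  have hmulinv (x y : A) : a1inv (mul x y) = mul (a1inv x) (a1inv y) := by
    rw [← ha1l (mul (a1inv x) (a1inv y)), hmul1, ha1r, ha1r]
  refine ⟨⟨?_, ?_, ?_, ?_⟩, ⟨?_, ?_, ?_, ?_, ?_⟩, ?_⟩
  · rintro ⟨x, u⟩
    exact Prod.ext (hcomm x) (hbcomm u)
  · rintro ⟨x, u⟩ ⟨y, v⟩
    exact Prod.ext (hmul1 x y) (by simp only [map_add, hl1, hr1])
  · rintro ⟨x, u⟩ ⟨y, v⟩
    exact Prod.ext (hmul2 x y) (by simp only [map_add, hl2, hr2])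
  · rintro ⟨x, u⟩ ⟨y, v⟩ ⟨z, w⟩
    refine Prod.ext (hassoc x y z) ?_
    simp only [map_add, hll, hrr, hlr]
    abel
  · rintro ⟨x, u⟩
    exact Prod.ext (hcomm x) (hbcomm u)
  · rintro ⟨x, u⟩ ⟨y, v⟩
    refine Prod.ext (hbr1 x y) ?_
    simp only [map_sub, hρ1, ← hcomm, ha1l, ha1r, hbinv]
  · rintro ⟨x, u⟩ ⟨y, v⟩
    refine Prod.ext (hbr2 x y) ?_
    simp only [map_sub, hρ2, hainv, hbinv, hb2l, hb2r]
  · rintro ⟨x, u⟩ ⟨y, v⟩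
    refine Prod.ext (hskew x y) ?_
    simp only [Prod.snd_neg, ← hcomm, ha1l, hb2l, neg_sub]
  · rintro ⟨x, u⟩ ⟨y, v⟩ ⟨z, w⟩
    refine Prod.ext (hjac x y z) ?_
    have key (x y : A) (u : V) :
        ρ (br (a1inv (a2 (a2 x))) (a2 y)) (b2 (b1 u)) =
          ρ (a2 (a2 x)) (ρ (a2 y) (b1 u)) - ρ (a2 (a2 y)) (ρ (a2 x) (b1 u)) := by
      have h := hρbr (a1inv (a2 x)) (a2 y) (b1 u)
      simpa only [hainv, ha1r] using h
    simp only [Prod.snd_add, Prod.snd_zero, map_sub, hbr2, hbrinv, ← hcomm, ha1l,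
      hbcomm, hb2l, key]
    abel
  · rintro ⟨x, u⟩ ⟨y, v⟩ ⟨z, w⟩
    refine Prod.ext (hleib x y z) ?_
    have key := hρmul (a1inv (a2 y)) (a1inv (a2 z)) (b2inv (b1 u))
    simp only [ha1r, hb2r, hbinv] at key
    simp only [Prod.snd_add, map_add, map_sub, hmul2, hmulinv, hlbr, hrbr, hbinv,
      hbcomm, hb2l, key]
    abel
end
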